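/- arXiv:2202.08457 — 2 statements merged into one kernel-verified Lean document; each statement's English description precedes it below -/
import Mathlib

section
/- The heat kernel φ is locally integrable on ℝⁿ × ℝ and is a fundamental solution of the heat operator ∂_t − Δ with pole at the origin: for every ψ ∈ C_c^∞(ℝⁿ × ℝ; ℝ) one has ∫_{ℝⁿ×ℝ} φ(x,t) ( −∂_t ψ(x,t) − Δψ(x,t) ) dx dt = ψ(0,0). -/
open MeasureTheory Real

noncomputable section

/-- Euclidean `n`-space. -/
abbrev Spc (n : ℕ) := EuclideanSpace ℝ (Fin n)

/-- Spatial partial derivative (in the `i`-th space variable) of a function on space-time. -/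
def sd {n : ℕ} (i : Fin n) (f : Spc n × ℝ → ℝ) (p : Spc n × ℝ) : ℝ :=
  fderiv ℝ (fun x => f (x, p.2)) p.1 (EuclideanSpace.single i 1)

/-- Time derivative of a function on space-time. -/
def td {n : ℕ} (f : Spc n × ℝ → ℝ) (p : Spc n × ℝ) : ℝ :=
  deriv (fun t => f (p.1, t)) p.2

/-- The heat kernel `φ(x,t) = (4πt)^{-n/2} exp(−|x|²/(4t))` for `t > 0`, and `0` for `t ≤ 0`. -/
def heatK (n : ℕ) (p : Spc n × ℝ) : ℝ :=
  if 0 < p.2 then (4 * π * p.2) ^ (-(n : ℝ) / 2) * Real.exp (-(∑ i, p.1 i ^ 2) / (4 * p.2))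
  else 0

open Filter Topology

/-- The heat kernel at time `1`. -/
def heatGauss (n : ℕ) (y : Spc n) : ℝ :=
  (4 * π) ^ (-(n : ℝ) / 2) * Real.exp (-(1 / 4) * ‖y‖ ^ 2)

lemma heatGauss_nonneg (n : ℕ) (y : Spc n) : 0 ≤ heatGauss n y := by
  unfold heatGauss; positivity

lemma integral_heatGauss (n : ℕ) : ∫ y, heatGauss n y = 1 := by
  unfold heatGauss
  rw [integral_const_mul, GaussianFourier.integral_rexp_neg_mul_sq_norm (by norm_num)]
  rw [finrank_euclideanSpace_fin, show π / (1 / 4) = 4 * π by ring,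
    ← Real.rpow_add (by positivity)]
  simp [neg_div]

lemma integrable_heatGauss (n : ℕ) : Integrable (heatGauss n) :=
  Integrable.of_integral_ne_zero (by simp [integral_heatGauss])

lemma contDiff_heatGauss (n : ℕ) : ContDiff ℝ 1 (heatGauss n) := by
  unfold heatGauss
  exact contDiff_const.mul (contDiff_const.mul (contDiff_norm_sq ℝ)).exp

lemma fderiv_heatGauss (n : ℕ) (y : Spc n) (i : Fin n) :
    fderiv ℝ (heatGauss n) y (EuclideanSpace.single i 1) = -(1 / 2) * (heatGauss n y * y i) := by
  have h := (((hasStrictFDerivAt_norm_sq y).hasFDerivAt.const_mul (-(1 / 4) : ℝ)).exp).const_mul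
    ((4 * π) ^ (-(n : ℝ) / 2))
  have h' : HasFDerivAt (heatGauss n) _ y := h
  rw [h'.fderiv]
  simp [heatGauss, EuclideanSpace.inner_single_right]
  ring

lemma heatK_nonneg (n : ℕ) (p : Spc n × ℝ) : 0 ≤ heatK n p := by
  unfold heatK; split_ifs <;> positivity

lemma measurable_heatK (n : ℕ) : Measurable (heatK n) := by
  unfold heatK
  refine Measurable.ite (measurableSet_lt measurable_const measurable_snd) ?_ measurable_const
  fun_prop

lemma heatK_smul {n : ℕ} {t : ℝ} (ht : 0 < t) (y : Spc n) :
    heatK n (√t • y, t) = (√t ^ n)⁻¹ * heatGauss n y := by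
  have h1 : ∑ i, (√t • y) i ^ 2 = t * ‖y‖ ^ 2 := by
    rw [← EuclideanSpace.real_norm_sq_eq, norm_smul, mul_pow, Real.norm_eq_abs, sq_abs,
      Real.sq_sqrt ht.le]
  have h2 : (√t ^ n)⁻¹ = t ^ (-(n : ℝ) / 2) := by
    rw [Real.sqrt_eq_rpow, ← Real.rpow_natCast, ← Real.rpow_mul ht.le, ← Real.rpow_neg ht.le]
    congr 1; ring
  simp only [heatK, heatGauss, if_pos ht, h1, h2]
  rw [Real.mul_rpow (by positivity) ht.le]
  rw [show -(t * ‖y‖ ^ 2) / (4 * t) = -(1 / 4) * ‖y‖ ^ 2 by field_simp]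
  ring

lemma integral_heatK_mul {n : ℕ} {t : ℝ} (ht : 0 < t) (f : Spc n → ℝ) :
    ∫ x, heatK n (x, t) * f x = ∫ y, heatGauss n y * f (√t • y) := by
  have hs : 0 < √t ^ n := by positivity
  have h := Measure.integral_comp_smul (volume : Measure (Spc n))
    (fun x => heatK n (x, t) * f x) (√t)
  simp only [heatK_smul ht, mul_assoc] at h
  rw [integral_const_mul, finrank_euclideanSpace_fin, abs_of_pos (inv_pos.2 hs), smul_eq_mul] at h
  exact (mul_left_cancel₀ (inv_pos.2 hs).ne' h).symm

lemma integral_heatK {n : ℕ} {t : ℝ} (ht : 0 < t) : ∫ x, heatK n (x, t) = 1 := by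
  simpa [integral_heatGauss] using integral_heatK_mul ht (fun _ : Spc n => 1)

lemma locallyIntegrable_heatK (n : ℕ) : LocallyIntegrable (heatK n) volume := by
  rw [locallyIntegrable_iff]
  intro K hK
  obtain ⟨T, hT⟩ := (hK.image continuous_snd).isBounded.subset_closedBall 0
  have hsub : K ⊆ Set.univ ×ˢ Metric.closedBall (0 : ℝ) T :=
    fun p hp => ⟨trivial, hT ⟨p, hp, rfl⟩⟩
  refine IntegrableOn.mono_set ?_ hsub
  rw [IntegrableOn, Measure.volume_eq_prod, ← Measure.prod_restrict, Measure.restrict_univ,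
    integrable_prod_iff' (measurable_heatK n).aestronglyMeasurable]
  have hval (t : ℝ) : ∫ x : Spc n, ‖heatK n (x, t)‖ = if 0 < t then 1 else 0 := by
    simp only [Real.norm_of_nonneg (heatK_nonneg n _)]
    split_ifs with ht
    · exact integral_heatK ht
    · simp [heatK, ht]
  refine ⟨Eventually.of_forall fun t => ?_, ?_⟩
  · by_cases ht : 0 < t
    · exact Integrable.of_integral_ne_zero (by simp [integral_heatK ht])
    · simp [heatK, ht]
  · simp only [hval]
    have : IsFiniteMeasure (volume.restrict (Metric.closedBall (0 : ℝ) T)) :=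
      ⟨by simpa using ENNReal.mul_lt_top (by simp) ENNReal.ofReal_lt_top⟩
    refine Integrable.of_bound (C := 1)
      (Measurable.ite measurableSet_Ioi measurable_const measurable_const).aestronglyMeasurable
      (Eventually.of_forall fun t => ?_)
    split_ifs <;> simp

lemma sd_eq_fderiv {n : ℕ} (i : Fin n) {f : Spc n × ℝ → ℝ} (hf : Differentiable ℝ f) :
    sd i f = fun p => fderiv ℝ f p (EuclideanSpace.single i 1, 0) := by
  ext p
  have h : HasFDerivAt (fun x => f (x, p.2)) _ p.1 :=
    (hf (p.1, p.2)).hasFDerivAt.comp p.1 (hasFDerivAt_prodMk_left p.1 p.2)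
  simp [sd, h.fderiv]

lemma td_eq_fderiv {n : ℕ} {f : Spc n × ℝ → ℝ} (hf : Differentiable ℝ f) :
    td f = fun p => fderiv ℝ f p (0, 1) := by
  ext p
  have h : HasDerivAt (fun t => f (p.1, t)) _ p.2 :=
    (hf (p.1, p.2)).hasFDerivAt.comp_hasDerivAt p.2
      ((hasDerivAt_const p.2 p.1).prodMk (hasDerivAt_id p.2))
  simp [td, h.deriv]

lemma contDiff_sd {n : ℕ} {m k : WithTop ℕ∞} (i : Fin n) {f : Spc n × ℝ → ℝ}
    (hf : ContDiff ℝ k f) (hk : m + 1 ≤ k) : ContDiff ℝ m (sd i f) := by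
  rw [sd_eq_fderiv i (hf.differentiable (by rintro rfl; simp at hk))]
  exact (hf.fderiv_right hk).clm_apply contDiff_const

lemma hasCompactSupport_sd {n : ℕ} (i : Fin n) {f : Spc n × ℝ → ℝ} (hf : Differentiable ℝ f)
    (hc : HasCompactSupport f) : HasCompactSupport (sd i f) := by
  rw [sd_eq_fderiv i hf]
  exact hc.fderiv_apply ℝ _

lemma continuous_td {n : ℕ} {f : Spc n × ℝ → ℝ} (hf : ContDiff ℝ 1 f) : Continuous (td f) := by
  rw [td_eq_fderiv (hf.differentiable one_ne_zero)]
  exact (hf.continuous_fderiv one_ne_zero).clm_apply continuous_const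

lemma hasCompactSupport_td {n : ℕ} {f : Spc n × ℝ → ℝ} (hf : Differentiable ℝ f)
    (hc : HasCompactSupport f) : HasCompactSupport (td f) := by
  rw [td_eq_fderiv hf]
  exact hc.fderiv_apply ℝ _

lemma integrable_heatGauss_mul {n : ℕ} {u : Spc n × ℝ → ℝ} (hu : Continuous u)
    (hc : HasCompactSupport u) (s t : ℝ) :
    Integrable fun y => heatGauss n y * u (s • y, t) := by
  obtain ⟨C, hC⟩ := hc.exists_bound_of_continuous hu
  exact (integrable_heatGauss n).mul_bdd (c := C)
    (by fun_prop : Continuous fun y : Spc n => u (s • y, t)).aestronglyMeasurable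
    (Eventually.of_forall fun y => hC _)

/-- Gaussian integration by parts. -/
lemma integral_heatGauss_mul_coord {n : ℕ} (i : Fin n) {u : Spc n × ℝ → ℝ} (hu : ContDiff ℝ 1 u)
    (hc : HasCompactSupport u) {t : ℝ} (ht : 0 < t) :
    ∫ y, heatGauss n y * ((√t • y) i * u (√t • y, t)) =
      2 * t * ∫ y, heatGauss n y * sd i u (√t • y, t) := by
  have hs : √t ≠ 0 := by positivity
  have hd := hu.differentiable one_ne_zero
  have hder (y : Spc n) : fderiv ℝ (fun y => u (√t • y, t)) y (EuclideanSpace.single i 1) =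
      √t * sd i u (√t • y, t) := by
    have h : HasFDerivAt (fun y : Spc n => u (√t • y, t)) _ y :=
      (hd (√t • y, t)).hasFDerivAt.comp (f := fun y : Spc n => (√t • y, t)) y
        (((hasFDerivAt_id y).const_smul (√t)).prodMk (hasFDerivAt_const t y))
    rw [h.fderiv, sd_eq_fderiv i hd]
    simp only [ContinuousLinearMap.comp_apply, ContinuousLinearMap.prod_apply,
      smul_apply, zero_apply, ContinuousLinearMap.id_apply]
    rw [← smul_eq_mul, ← map_smul, Prod.smul_mk, smul_zero]
  have hcoord : Continuous fun p : Spc n × ℝ => p.1 i * u p :=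
    (by fun_prop : Continuous fun p : Spc n × ℝ => p.1 i).mul hu.continuous
  have hI1 := integrable_heatGauss_mul hcoord hc.mul_left (√t) t
  have hI2 : Integrable fun y => heatGauss n y * sd i u (√t • y, t) := by
    exact integrable_heatGauss_mul (contDiff_sd (m := 0) i hu (by simp)).continuous
      (hasCompactSupport_sd i hd hc) _ _
  have hfG (y : Spc n) : fderiv ℝ (heatGauss n) y (EuclideanSpace.single i 1) * u (√t • y, t) =
      (-(1 / 2) * (√t)⁻¹) * (heatGauss n y * ((√t • y) i * u (√t • y, t))) := by
    rw [fderiv_heatGauss]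
    simp only [PiLp.smul_apply, smul_eq_mul]
    field_simp
  have key := integral_mul_fderiv_eq_neg_fderiv_mul_of_integrable (μ := volume)
    (f := heatGauss n) (g := fun y => u (√t • y, t)) (v := EuclideanSpace.single i 1)
    (by simp only [hfG]; exact hI1.const_mul _)
    (by simp only [hder, mul_left_comm _ (√t)]; exact hI2.const_mul _)
    (integrable_heatGauss_mul hu.continuous hc _ _)
    (fun y _ => (contDiff_heatGauss n).differentiable one_ne_zero y)
    (fun y _ => (hd _).comp y (by fun_prop))
  simp only [hder, hfG, mul_left_comm _ (√t)] at key
  rw [integral_const_mul, integral_const_mul] at key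
  field_simp at key
  rw [Real.sq_sqrt ht.le] at key
  simp only [mul_assoc] at key
  linarith

lemma continuous_integral_heatGauss_mul {n : ℕ} {u : Spc n × ℝ → ℝ} (hu : Continuous u)
    (hc : HasCompactSupport u) : Continuous fun t => ∫ y, heatGauss n y * u (√t • y, t) := by
  obtain ⟨C, hC⟩ := hc.exists_bound_of_continuous hu
  refine continuous_of_dominated (bound := fun y => heatGauss n y * C)
    (fun t => (integrable_heatGauss_mul hu hc _ _).aestronglyMeasurable)
    (fun t => Eventually.of_forall fun y => ?_) ((integrable_heatGauss n).mul_const C)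
    (Eventually.of_forall fun y => by fun_prop)
  rw [norm_mul, Real.norm_of_nonneg (heatGauss_nonneg n y)]
  exact mul_le_mul_of_nonneg_left (hC _) (heatGauss_nonneg n y)

lemma hasDerivAt_integral_heatGauss_mul {n : ℕ} {u : Spc n × ℝ → ℝ} (hu : ContDiff ℝ 2 u)
    (hc : HasCompactSupport u) {t : ℝ} (ht : 0 < t) :
    HasDerivAt (fun t => ∫ y, heatGauss n y * u (√t • y, t))
      (∫ y, heatGauss n y * (td u (√t • y, t) + ∑ i, sd i (sd i u) (√t • y, t))) t := by
  have hd := hu.differentiable two_ne_zero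
  have hfc : Continuous (fderiv ℝ u) := hu.continuous_fderiv two_ne_zero
  have htc := continuous_td (hu.of_le one_le_two)
  have hts := hasCompactSupport_td hd hc
  have hsC (i : Fin n) : ContDiff ℝ 1 (sd i u) := contDiff_sd i hu one_add_one_eq_two.le
  have hss (i : Fin n) := hasCompactSupport_sd i hd hc
  have hssc (i : Fin n) : Continuous (sd i (sd i u)) :=
    (contDiff_sd (m := 0) i (hsC i) (by simp)).continuous
  have hsss (i : Fin n) := hasCompactSupport_sd i ((hsC i).differentiable one_ne_zero) (hss i)
  let w : Spc n × ℝ → ℝ := fun p => fderiv ℝ u p (p.1, 0)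
  have hwc : Continuous w := by fun_prop
  have hws : HasCompactSupport w := (hc.fderiv ℝ).mono fun p hp h => hp (by simp [w, h])
  have hw (p : Spc n × ℝ) : w p = ∑ i, p.1 i * sd i u p := by
    have h : (p.1, (0 : ℝ)) = ∑ i, p.1 i • (EuclideanSpace.single i (1 : ℝ), (0 : ℝ)) := by
      ext j
      · simp [Prod.fst_sum, Finset.sum_apply, Pi.single_apply]
      · simp [Prod.snd_sum]
    simp only [w, h, map_sum, map_smul, smul_eq_mul]
    exact Finset.sum_congr rfl fun i _ => by rw [sd_eq_fderiv i hd]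
  obtain ⟨A, hA⟩ := hts.exists_bound_of_continuous htc
  obtain ⟨B, hB⟩ := hws.exists_bound_of_continuous hwc
  have hcurve (y : Spc n) (r : ℝ) (hr : 0 < r) : HasDerivAt (fun r => heatGauss n y * u (√r • y, r))
      (heatGauss n y * (td u (√r • y, r) + (2 * r)⁻¹ * w (√r • y, r))) r := by
    have h := (hd (√r • y, r)).hasFDerivAt.comp_hasDerivAt (f := fun r => (√r • y, r)) r
      (((Real.hasDerivAt_sqrt hr.ne').smul_const y).prodMk (hasDerivAt_id r))
    refine (h.const_mul (heatGauss n y)).congr_deriv ?_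
    congr 1
    have hv : ((1 / (2 * √r)) • y, (1 : ℝ)) = (0, 1) + (2 * r)⁻¹ • (√r • y, (0 : ℝ)) := by
      have : 1 / (2 * √r) = (2 * r)⁻¹ * √r := by
        have := Real.sq_sqrt hr.le
        have : √r ≠ 0 := by positivity
        field_simp
        linarith
      simp [this, smul_smul]
    rw [hv, map_add, map_smul, td_eq_fderiv hd, smul_eq_mul]
  have hmain := (hasDerivAt_integral_of_dominated_loc_of_deriv_le (μ := volume)
    (F := fun r y => heatGauss n y * u (√r • y, r))
    (F' := fun r y => heatGauss n y * (td u (√r • y, r) + (2 * r)⁻¹ * w (√r • y, r)))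
    (bound := fun y => heatGauss n y * (A + t⁻¹ * B)) (x₀ := t) (s := Set.Ioi (t / 2))
    (Ioi_mem_nhds (by linarith))
    (Eventually.of_forall fun r =>
      (integrable_heatGauss_mul hu.continuous hc _ _).aestronglyMeasurable)
    (integrable_heatGauss_mul hu.continuous hc _ _)
    (integrable_heatGauss_mul (u := fun p => td u p + (2 * t)⁻¹ * w p) (by fun_prop)
      (hts.add hws.mul_left) _ _).aestronglyMeasurable
    (Eventually.of_forall fun y r hr => by
      have hr' : t / 2 < r := hr
      have hr0 : 0 < r := by linarith
      rw [norm_mul, Real.norm_of_nonneg (heatGauss_nonneg n y)]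
      refine mul_le_mul_of_nonneg_left ((norm_add_le _ _).trans (add_le_add (hA _) ?_))
        (heatGauss_nonneg n y)
      rw [norm_mul, Real.norm_of_nonneg (by positivity)]
      exact mul_le_mul (inv_anti₀ ht (by linarith)) (hB _) (norm_nonneg _) (by positivity))
    ((integrable_heatGauss n).mul_const _)
    (Eventually.of_forall fun y r hr => hcurve y r ((half_pos ht).trans hr))).2
  refine hmain.congr_deriv ?_
  have hIt := integrable_heatGauss_mul htc hts (√t) t
  have hIw := integrable_heatGauss_mul hwc hws (√t) t
  have hIs (i : Fin n) := integrable_heatGauss_mul (hssc i) (hsss i) (√t) t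
  have hIc (i : Fin n) := integrable_heatGauss_mul (u := fun p => p.1 i * sd i u p)
    ((by fun_prop : Continuous fun p : Spc n × ℝ => p.1 i).mul (hsC i).continuous)
    (hss i).mul_left (√t) t
  simp only [mul_add, Finset.mul_sum, mul_left_comm _ (2 * t)⁻¹]
  rw [integral_add hIt (hIw.const_mul _), integral_add hIt (integrable_finsetSum _ fun i _ => hIs i),
    integral_const_mul, integral_finsetSum _ fun i _ => hIs i]
  simp only [hw, Finset.mul_sum]
  rw [integral_finsetSum _ fun i _ => hIc i, Finset.mul_sum]
  congr 1
  refine Finset.sum_congr rfl fun i _ => ?_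
  rw [integral_heatGauss_mul_coord i (hsC i) (hss i) ht]
  field_simp

/-- **The heat kernel is locally integrable on `ℝⁿ × ℝ` and is a fundamental solution of the
heat operator `∂_t − Δ` with pole at the origin**: for every `ψ ∈ C_c^∞(ℝⁿ × ℝ; ℝ)`,
`∫ φ (−∂_t ψ − Δψ) dx dt = ψ(0,0)`. -/
theorem stmt_3 (n : ℕ) :
    LocallyIntegrable (heatK n) volume ∧
    ∀ ψ : Spc n × ℝ → ℝ, ContDiff ℝ (⊤ : ℕ∞) ψ → HasCompactSupport ψ →
      (∫ p : Spc n × ℝ, heatK n p * (-(td ψ p) - ∑ i, sd i (sd i ψ) p)) = ψ (0, 0) := by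
  refine ⟨locallyIntegrable_heatK n, fun ψ hψ hc => ?_⟩
  have h2 : ContDiff ℝ 2 ψ := hψ.of_le (WithTop.coe_le_coe.2 le_top)
  have hd := h2.differentiable two_ne_zero
  have hsC (i : Fin n) : ContDiff ℝ 1 (sd i ψ) := contDiff_sd i h2 one_add_one_eq_two.le
  let H : Spc n × ℝ → ℝ := fun p => td ψ p + ∑ i, sd i (sd i ψ) p
  have hHc : Continuous H := (continuous_td (h2.of_le one_le_two)).add
    (continuous_finsetSum _ fun i _ => (contDiff_sd (m := 0) i (hsC i) (by simp)).continuous)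
  have hHs : HasCompactSupport H := by
    refine (hasCompactSupport_td hd hc).add ?_
    have hs (i : Fin n) := hasCompactSupport_sd i ((hsC i).differentiable one_ne_zero)
      (hasCompactSupport_sd i hd hc)
    refine HasCompactSupport.intro (isCompact_iUnion fun i => (hs i).isCompact) fun p hp => ?_
    exact Finset.sum_eq_zero fun i _ =>
      image_eq_zero_of_notMem_tsupport fun h => hp (Set.mem_iUnion_of_mem i h)
  have hint : Integrable (fun p => heatK n p * H p) (volume.prod volume) :=
    (locallyIntegrable_heatK n).integrable_smul_right_of_hasCompactSupport hHc hHs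
  have hslice : ∀ t ∈ Set.Ioi (0 : ℝ),
      ∫ x, heatK n (x, t) * H (x, t) = ∫ y, heatGauss n y * H (√t • y, t) :=
    fun t ht => integral_heatK_mul ht fun x => H (x, t)
  have hzero : Tendsto (fun t => ∫ y, heatGauss n y * ψ (√t • y, t)) atTop (𝓝 0) := by
    obtain ⟨T, hT⟩ := (hc.isCompact.image continuous_snd).bddAbove
    refine tendsto_const_nhds.congr' ?_
    filter_upwards [eventually_gt_atTop T] with t ht
    have h0 (x : Spc n) : ψ (x, t) = 0 :=
      image_eq_zero_of_notMem_tsupport fun h => ht.not_ge (hT ⟨_, h, rfl⟩)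
    simp [h0]
  have hftc := integral_Ioi_of_hasDerivAt_of_tendsto
    (continuous_integral_heatGauss_mul h2.continuous hc).continuousWithinAt
    (fun t ht => hasDerivAt_integral_heatGauss_mul h2 hc ht)
    (hint.integral_prod_right.integrableOn.congr_fun hslice measurableSet_Ioi) hzero
  have hval : ∫ p, heatK n p * H p = -ψ (0, 0) := by
    rw [Measure.volume_eq_prod, integral_prod_symm _ hint,
      ← setIntegral_eq_integral_of_forall_compl_eq_zero (s := Set.Ioi 0),
      setIntegral_congr_fun measurableSet_Ioi hslice]
    · simpa [integral_mul_const, integral_heatGauss] using hftc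
    · intro t ht
      have ht' : ¬ 0 < t := ht
      simp [heatK, ht']
  rw [← neg_neg (ψ (0, 0)), ← hval, ← integral_neg]
  congr 1
  ext p
  simp only [H]
  ring
end
end

section
/- Let n ≥ 1, μ > 0, λ + μ ≥ 0 and let ℒ⁰u = ∂_t u − μΔu − (μ+λ)∇(div u) be the parabolic Lamé operator with zero lower-order coefficients. Then for every point (x₀,t₀) ∈ ℝⁿ × ℝ and every δ > 0 there exists a smooth vector field v₀ : ℝⁿ × ℝ → ℝⁿ satisfying ℒ⁰v₀ = 0 at every point of ℝⁿ × ℝ, such that v₀(x₀,t₀) ≠ 0 and v₀(x,t) = 0 for all x ∈ ℝⁿ whenever |t − t₀| ≥ δ. -/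
open MeasureTheory Real

noncomputable section

/-- The entries of the Lamé kernel:
`Φ_{ij}(x,t) = φ(x,μt) δ_{ij} + ∫_{μt}^{(2μ+λ)t} ∂²φ/∂x_i∂x_j (x,ζ) dζ` for `t > 0`,
and `0` for `t ≤ 0`. -/
def lameK (n : ℕ) (μ lam : ℝ) (i j : Fin n) (p : Spc n × ℝ) : ℝ :=
  if 0 < p.2 then
    (if i = j then heatK n (p.1, μ * p.2) else 0)
      + ∫ ζ in (μ * p.2)..((2 * μ + lam) * p.2), sd i (sd j (heatK n)) (p.1, ζ)
  else 0

/-- The parabolic Lamé operator `ℒ⁰u = ∂_t u − μΔu − (μ+λ)∇(div u)`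
with zero lower-order coefficients, acting on vector fields on space-time;
`lame0 n μ lam u p i` is the `i`-th component of `ℒ⁰u` at the point `p`. -/
def lame0 (n : ℕ) (μ lam : ℝ) (u : Spc n × ℝ → Fin n → ℝ) (p : Spc n × ℝ) (i : Fin n) : ℝ :=
  td (fun q => u q i) p - μ * ∑ k, sd k (sd k (fun q => u q i)) p
    - (μ + lam) * sd i (fun q => ∑ k, sd k (fun q' => u q' k) q) p

lemma pow_mul_exp_neg_sq_le {x ε : ℝ} (hx : 0 ≤ x) (hε : 0 < ε) (k : ℕ) :
    x ^ k * exp (-(x ^ 2 / 5)) ≤ exp (5 / (4 * ε ^ 2)) * (ε ^ k * k.factorial) := by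
  have h1 : (x / ε) ^ k / k.factorial ≤ exp (x / ε) := pow_div_factorial_le_exp _ (by positivity) k
  have h2 : x ^ k ≤ exp (x / ε) * (ε ^ k * k.factorial) := by
    have hk : (0 : ℝ) < k.factorial := by positivity
    rw [div_le_iff₀ hk, div_pow, div_le_iff₀ (by positivity)] at h1
    linarith
  calc x ^ k * exp (-(x ^ 2 / 5))
      ≤ exp (x / ε) * (ε ^ k * k.factorial) * exp (-(x ^ 2 / 5)) := by gcongr
    _ = exp (x / ε - x ^ 2 / 5) * (ε ^ k * k.factorial) := by
        rw [sub_eq_add_neg, exp_add]; ring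
    _ ≤ _ := by
        gcongr
        have : 5 / (4 * ε ^ 2) - (x / ε - x ^ 2 / 5) = (x - 5 / (2 * ε)) ^ 2 / 5 := by
          field_simp; ring
        have h : 0 ≤ (x - 5 / (2 * ε)) ^ 2 / 5 := by positivity
        linarith

lemma ne_zero_and_le_re_inv_sq {a : ℝ} {z : ℂ} (ha : 0 < a) (hz : ‖z - a‖ ≤ a / 4) :
    z ≠ 0 ∧ a⁻¹ ^ 2 / 5 ≤ ((z ^ 2)⁻¹).re := by
  have h1 := (Complex.abs_re_le_norm (z - a)).trans hz
  have h2 := (Complex.abs_im_le_norm (z - a)).trans hz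
  simp only [Complex.sub_re, Complex.ofReal_re, Complex.sub_im, Complex.ofReal_im, sub_zero,
    abs_le] at h1 h2
  obtain ⟨x, y⟩ := z
  simp only at h1 h2
  have hx : 3 / 4 * a ≤ x := by linarith
  have hx' : x ≤ 5 / 4 * a := by linarith
  have hy : y ^ 2 ≤ (a / 4) ^ 2 := sq_le_sq' (by linarith) h2.2
  have hx2 : (3 / 4 * a) ^ 2 ≤ x ^ 2 := by gcongr
  have hx0 : 0 ≤ x := by linarith
  have hx3 : x ^ 2 ≤ (5 / 4 * a) ^ 2 := by gcongr
  refine ⟨fun h => by rw [Complex.ext_iff] at h; simp at h; linarith [h.1], ?_⟩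
  have hp : 0 < x ^ 2 + y ^ 2 := by nlinarith
  have e : (((⟨x, y⟩ : ℂ) ^ 2)⁻¹).re = (x ^ 2 - y ^ 2) / (x ^ 2 + y ^ 2) ^ 2 := by
    rw [Complex.inv_re, map_pow, Complex.normSq_mk]
    simp [pow_two]
  rw [e, le_div_iff₀ (by positivity), inv_pow, div_mul_eq_mul_div, div_le_iff₀ (by norm_num),
    inv_mul_le_iff₀ (by positivity)]
  have hs : x ^ 2 + y ^ 2 ≤ 13 / 8 * a ^ 2 := by nlinarith
  have hs2 : (x ^ 2 + y ^ 2) ^ 2 ≤ (13 / 8 * a ^ 2) ^ 2 := by gcongr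
  have hd : a ^ 2 / 2 ≤ x ^ 2 - y ^ 2 := by nlinarith
  nlinarith [mul_le_mul_of_nonneg_left hd (sq_nonneg a), sq_nonneg (a ^ 2)]

/-- The holomorphic function `exp (-1/z² - 1/(1-z)²)`. -/
def flatC (z : ℂ) : ℂ := Complex.exp (-(z ^ 2)⁻¹ - ((1 - z) ^ 2)⁻¹)

/-- The `k`-th derivative of the bump `exp (-1/t² - 1/(1-t)²)` on `(0, 1)`, extended by zero. -/
def flatD (k : ℕ) (t : ℝ) : ℝ :=
  if 0 < t ∧ t < 1 then (iteratedDeriv k flatC t).re else 0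

lemma flatC_analyticAt {z : ℂ} (h0 : z ≠ 0) (h1 : 1 - z ≠ 0) : AnalyticAt ℂ flatC z := by
  unfold flatC
  have := pow_ne_zero 2 h0
  have := pow_ne_zero 2 h1
  fun_prop (disch := assumption)

lemma norm_iteratedDeriv_flatC_le {t : ℝ} (h0 : 0 < t) (h1 : t < 1) (k : ℕ) :
    ‖iteratedDeriv k flatC t‖ ≤
      k.factorial * exp (-((min t (1 - t))⁻¹ ^ 2 / 5)) / (min t (1 - t) / 4) ^ k := by
  have hd : 0 < min t (1 - t) := lt_min h0 (by linarith)
  have key : ∀ z ∈ Metric.closedBall (t : ℂ) (min t (1 - t) / 4),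
      AnalyticAt ℂ flatC z ∧ ‖flatC z‖ ≤ exp (-((min t (1 - t))⁻¹ ^ 2 / 5)) := by
    intro z hz
    rw [mem_closedBall_iff_norm] at hz
    obtain ⟨a1, a2⟩ := ne_zero_and_le_re_inv_sq h0
      (hz.trans (by gcongr; exact min_le_left _ _))
    obtain ⟨b1, b2⟩ := ne_zero_and_le_re_inv_sq (a := 1 - t) (z := 1 - z) (by linarith) (by
      rw [← norm_neg]
      rw [show -(1 - z - ((1 - t : ℝ) : ℂ)) = z - t by push_cast; ring]
      exact hz.trans (by gcongr; exact min_le_right _ _))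
    refine ⟨flatC_analyticAt a1 b1, ?_⟩
    rw [flatC, Complex.norm_exp, Complex.sub_re, Complex.neg_re]
    apply exp_le_exp.2
    have p1 : 0 ≤ t⁻¹ ^ 2 := by positivity
    have p2 : 0 ≤ (1 - t)⁻¹ ^ 2 := by positivity
    rcases min_choice t (1 - t) with h | h <;> rw [h] <;> linarith
  refine Complex.norm_iteratedDeriv_le_of_forall_mem_sphere_norm_le k (by positivity) ?_
    fun z hz => (key z (Metric.sphere_subset_closedBall hz)).2
  exact DifferentiableOn.diffContOnCl_ball
    (fun z hz => (key z hz).1.differentiableAt.differentiableWithinAt) subset_rfl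

lemma abs_flatD_le {t : ℝ} (h0 : 0 < t) (h1 : t < 1) (k : ℕ) :
    |flatD k t| ≤ k.factorial * 4 ^ k *
      ((min t (1 - t))⁻¹ ^ k * exp (-((min t (1 - t))⁻¹ ^ 2 / 5))) := by
  rw [flatD, if_pos ⟨h0, h1⟩]
  refine (Complex.abs_re_le_norm _).trans ((norm_iteratedDeriv_flatC_le h0 h1 k).trans_eq ?_)
  have hd : 0 < min t (1 - t) := lt_min h0 (by linarith)
  rw [div_pow, inv_pow _ k]
  field_simp

lemma flatD_gevrey {ε : ℝ} (hε : 0 < ε) :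
    ∃ C : ℝ, ∀ (k : ℕ) (t : ℝ), |flatD k t| ≤ C * (ε ^ k * (2 * k).factorial) := by
  refine ⟨exp (5 / (4 * (ε / 4) ^ 2)), fun k t => ?_⟩
  by_cases ht : 0 < t ∧ t < 1
  · have hd : 0 < min t (1 - t) := lt_min ht.1 (by linarith)
    have hk : ((k.factorial * k.factorial : ℕ) : ℝ) ≤ (2 * k).factorial := by
      rw [two_mul]
      exact_mod_cast Nat.le_of_dvd (Nat.factorial_pos _)
        (Nat.factorial_mul_factorial_dvd_factorial_add k k)
    calc |flatD k t| ≤ k.factorial * 4 ^ k *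
          (exp (5 / (4 * (ε / 4) ^ 2)) * ((ε / 4) ^ k * k.factorial)) :=
        (abs_flatD_le ht.1 ht.2 k).trans (by
          gcongr k.factorial * 4 ^ k * ?_
          exact pow_mul_exp_neg_sq_le (by positivity) (by positivity) k)
      _ = exp (5 / (4 * (ε / 4) ^ 2)) * (ε ^ k * (k.factorial * k.factorial : ℕ)) := by
        push_cast
        have : (4 : ℝ) ^ k * (ε / 4) ^ k = ε ^ k := by rw [← mul_pow]; ring_nf
        rw [← this]
        ring
      _ ≤ _ := by gcongr
  · rw [flatD, if_neg ht, abs_zero]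
    positivity

lemma flatD_le_sq (k : ℕ) : ∃ K : ℝ, 0 ≤ K ∧ ∀ t s : ℝ, ¬ (0 < t ∧ t < 1) →
    |flatD k s| ≤ K * |s - t| ^ 2 := by
  refine ⟨k.factorial * 4 ^ k * (exp (5 / (4 * 1 ^ 2)) * (1 ^ (k + 2) * (k + 2).factorial)),
    by positivity, fun t s ht => ?_⟩
  by_cases hs : 0 < s ∧ s < 1
  · have hd : 0 < min s (1 - s) := lt_min hs.1 (by linarith)
    have hle : min s (1 - s) ≤ |s - t| := by
      by_cases h : 0 < t
      · have : 1 ≤ t := by by_contra h'; exact ht ⟨h, not_le.1 h'⟩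
        exact (min_le_right _ _).trans ((by linarith : 1 - s ≤ -(s - t)).trans (neg_le_abs _))
      · exact (min_le_left _ _).trans ((by linarith : s ≤ s - t).trans (le_abs_self _))
    have := pow_mul_exp_neg_sq_le (x := (min s (1 - s))⁻¹) (by positivity) one_pos (k + 2)
    calc |flatD k s| ≤ _ := abs_flatD_le hs.1 hs.2 k
      _ = k.factorial * 4 ^ k * ((min s (1 - s))⁻¹ ^ (k + 2) *
            exp (-((min s (1 - s))⁻¹ ^ 2 / 5))) * min s (1 - s) ^ 2 := by
          rw [inv_pow _ (k + 2), inv_pow _ k]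
          field_simp
          ring
      _ ≤ _ := by gcongr
  · rw [flatD, if_neg hs, abs_zero]
    positivity

lemma hasDerivAt_flatD (k : ℕ) (t : ℝ) : HasDerivAt (flatD k) (flatD (k + 1) t) t := by
  by_cases ht : 0 < t ∧ t < 1
  · have ha : AnalyticAt ℂ flatC t := flatC_analyticAt (by exact_mod_cast ht.1.ne')
      (by exact_mod_cast (sub_pos.2 ht.2).ne')
    have hd : HasDerivAt (iteratedDeriv k flatC) (iteratedDeriv (k + 1) flatC t) t := by
      rw [iteratedDeriv_succ, iteratedDeriv_eq_iterate]
      exact (ha.iterated_deriv k).differentiableAt.hasDerivAt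
    have hr := hd.real_of_complex
    rw [show flatD (k + 1) t = (iteratedDeriv (k + 1) flatC t).re from if_pos ht]
    refine hr.congr_of_eventuallyEq ?_
    filter_upwards [Ioo_mem_nhds ht.1 ht.2] with s hs
    exact if_pos hs
  · obtain ⟨K, hK0, hK⟩ := flatD_le_sq k
    have z : ∀ j, flatD j t = 0 := fun j => if_neg ht
    rw [z, hasDerivAt_iff_isLittleO, z]
    have : (fun s => flatD k s - 0 - (s - t) • (0 : ℝ)) =O[nhds t] fun s => (s - t) ^ 2 :=
      Asymptotics.IsBigO.of_bound K (Filter.Eventually.of_forall fun s => by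
        simpa using hK t s ht)
    refine this.trans_isLittleO ?_
    have h : Filter.Tendsto (fun s => s - t) (nhds t) (nhds 0) := by
      have : Continuous fun s : ℝ => s - t := by fun_prop
      simpa using this.tendsto t
    simpa using! (Asymptotics.isLittleO_pow_id (one_lt_two)).comp_tendsto h

lemma flatD_zero_half : flatD 0 (1 / 2) ≠ 0 := by
  rw [flatD, if_pos (by norm_num), iteratedDeriv_zero, flatC]
  have : (-(((1 / 2 : ℝ) : ℂ) ^ 2)⁻¹ - ((1 - ((1 / 2 : ℝ) : ℂ)) ^ 2)⁻¹) = ((-8 : ℝ) : ℂ) := by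
    push_cast; norm_num
  rw [this, ← Complex.ofReal_exp, Complex.ofReal_re]
  positivity

/-- The power series `∑ c_{k+m}(t) y^k / k!` at the point `(y, t)`. -/
def tychSeries (c : ℕ → ℝ → ℝ) (m : ℕ) (p : ℝ × ℝ) : ℝ :=
  ∑' k : ℕ, c (k + m) p.2 * (p.1 ^ k / k.factorial)

lemma tychSeries_bound {c : ℕ → ℝ → ℝ}
    (hc : ∀ ε : ℝ, 0 < ε → ∃ C : ℝ, ∀ k t, |c k t| ≤ C * (ε ^ k * k.factorial))
    (m : ℕ) {B : ℝ} (hB : 0 ≤ B) :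
    ∃ u : ℕ → ℝ, Summable u ∧ ∀ (k : ℕ) (y t : ℝ), |y| ≤ B →
      |c (k + m) t * (y ^ k / k.factorial)| ≤ u k := by
  obtain ⟨C, hC⟩ := hc (1 / (2 * (B + 1))) (by positivity)
  set ε : ℝ := 1 / (2 * (B + 1)) with hε
  have hε0 : 0 < ε := by positivity
  have hr : ‖ε * B‖ < 1 := by
    rw [norm_of_nonneg (by positivity), hε, div_mul_eq_mul_div, div_lt_one (by positivity)]
    linarith
  refine ⟨fun k => C * ε ^ m * ((k + m).descFactorial m * (ε * B) ^ k),
    (summable_descFactorial_mul_geometric_of_norm_lt_one m hr).mul_left _, fun k y t hy => ?_⟩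
  have hf : ((k + m).factorial : ℝ) = k.factorial * (k + m).descFactorial m := by
    have := Nat.factorial_mul_descFactorial (Nat.le_add_left m k)
    rw [Nat.add_sub_cancel] at this
    exact_mod_cast this.symm
  rw [abs_mul, abs_div, abs_pow, Nat.abs_cast]
  calc |c (k + m) t| * (|y| ^ k / k.factorial)
      ≤ C * (ε ^ (k + m) * (k + m).factorial) * (B ^ k / k.factorial) :=
        mul_le_mul (hC _ t) (by gcongr) (by positivity) ((abs_nonneg _).trans (hC _ t))
    _ = _ := by
        rw [hf]
        have : (k.factorial : ℝ) ≠ 0 := by positivity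
        field_simp
        ring

lemma hasFDerivAt_tychSeries {c : ℕ → ℝ → ℝ} {κ : ℝ}
    (hc : ∀ ε : ℝ, 0 < ε → ∃ C : ℝ, ∀ k t, |c k t| ≤ C * (ε ^ k * k.factorial))
    (hd : ∀ k t, HasDerivAt (c k) (κ * c (k + 2) t) t) (m : ℕ) (p : ℝ × ℝ) :
    HasFDerivAt (tychSeries c m)
      (tychSeries c (m + 1) p • ContinuousLinearMap.fst ℝ ℝ ℝ +
        (κ * tychSeries c (m + 2) p) • ContinuousLinearMap.snd ℝ ℝ ℝ) p := by
  set B : ℝ := |p.1| + 1 with hB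
  have hB0 : 0 ≤ B := by positivity
  obtain ⟨u₀, hu₀, hb₀⟩ := tychSeries_bound hc m hB0
  obtain ⟨u₁, hu₁, hb₁⟩ := tychSeries_bound hc (m + 1) hB0
  obtain ⟨u₂, hu₂, hb₂⟩ := tychSeries_bound hc (m + 2) hB0
  let a : ℕ → ℝ × ℝ → ℝ := fun k q =>
    Nat.casesOn k 0 fun j => c (j + (m + 1)) q.2 * (q.1 ^ j / j.factorial)
  let v : ℕ → ℝ := fun k => Nat.casesOn k 0 u₁
  have hv : Summable v := (summable_nat_add_iff 1).1 hu₁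
  let f' : ℕ → ℝ × ℝ → (ℝ × ℝ →L[ℝ] ℝ) := fun k q =>
    a k q • ContinuousLinearMap.fst ℝ ℝ ℝ +
      (κ * (c (k + (m + 2)) q.2 * (q.1 ^ k / k.factorial))) • ContinuousLinearMap.snd ℝ ℝ ℝ
  let s : Set (ℝ × ℝ) := Metric.ball 0 B ×ˢ Set.univ
  have mem_s : ∀ q : ℝ × ℝ, q ∈ s ↔ |q.1| < B := fun q => by simp [s]
  have hps : p ∈ s := (mem_s p).2 (by linarith)
  have hav : ∀ k, ∀ q ∈ s, |a k q| ≤ v k := by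
    intro k q hq
    cases k with
    | zero => simp [a, v]
    | succ j => exact hb₁ j q.1 q.2 ((mem_s q).1 hq).le
  have hterm : ∀ (k : ℕ) (q : ℝ × ℝ), q ∈ s →
      HasFDerivAt (fun q : ℝ × ℝ => c (k + m) q.2 * (q.1 ^ k / k.factorial)) (f' k q) q := by
    intro k q _
    have h1 : HasFDerivAt (fun q : ℝ × ℝ => c (k + m) q.2) _ q :=
      (hd (k + m) q.2).comp_hasFDerivAt q (hasFDerivAt_snd (𝕜 := ℝ) (p := q))
    have h2 : HasFDerivAt (fun q : ℝ × ℝ => q.1 ^ k / k.factorial) _ q :=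
      ((hasDerivAt_pow k q.1).div_const (k.factorial : ℝ)).comp_hasFDerivAt q
        (hasFDerivAt_fst (𝕜 := ℝ) (p := q))
    refine (h1.mul h2).congr_fderiv ?_
    ext
    · cases k with
      | zero => simp [f', a]
      | succ j =>
        simp [f', a, Nat.factorial_succ]
        rw [show j + 1 + m = j + (m + 1) by ring]
        have : (j.factorial : ℝ) ≠ 0 := by positivity
        field_simp
    · simp [f', add_assoc]; ring
  have hsum : Summable fun k => v k + |κ| * u₂ k := hv.add (hu₂.mul_left _)
  have hnorm : ∀ k, ∀ q ∈ s, ‖f' k q‖ ≤ v k + |κ| * u₂ k := by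
    intro k q hq
    refine (norm_add_le _ _).trans ?_
    rw [norm_smul, norm_smul, norm_mul]
    have h2 := hb₂ k q.1 q.2 ((mem_s q).1 hq).le
    refine add_le_add ?_ ?_
    · exact (mul_le_of_le_one_right (norm_nonneg _) (ContinuousLinearMap.norm_fst_le ..)).trans
        (hav k q hq)
    · refine (mul_le_of_le_one_right (by positivity) (ContinuousLinearMap.norm_snd_le ..)).trans ?_
      exact mul_le_mul_of_nonneg_left h2 (abs_nonneg κ)
  have main := hasFDerivAt_tsum_of_isPreconnected hsum (Metric.isOpen_ball.prod isOpen_univ)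
    ((convex_ball _ _).isPreconnected.prod isPreconnected_univ) hterm hnorm hps
    (Summable.of_norm_bounded hu₀ fun k => hb₀ k p.1 p.2 (by linarith)) hps
  refine main.congr_fderiv ?_
  have s1 : HasSum (fun k => a k p) (tychSeries c (m + 1) p) := by
    rw [← hasSum_nat_add_iff' 1]
    simpa [a] using! (Summable.of_norm_bounded hu₁
      fun k => hb₁ k p.1 p.2 (by linarith)).hasSum
  have s2 : HasSum (fun k : ℕ => c (k + (m + 2)) p.2 * (p.1 ^ k / k.factorial))
      (tychSeries c (m + 2) p) :=
    (Summable.of_norm_bounded hu₂ fun k => hb₂ k p.1 p.2 (by linarith)).hasSum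
  exact ((s1.smul_const _).add ((s2.mul_left κ).smul_const _)).tsum_eq

lemma contDiff_tychSeries {c : ℕ → ℝ → ℝ} {κ : ℝ}
    (hc : ∀ ε : ℝ, 0 < ε → ∃ C : ℝ, ∀ k t, |c k t| ≤ C * (ε ^ k * k.factorial))
    (hd : ∀ k t, HasDerivAt (c k) (κ * c (k + 2) t) t) (m : ℕ) :
    ContDiff ℝ (⊤ : ℕ∞) (tychSeries c m) := by
  refine contDiff_infty.2 fun N => ?_
  induction N generalizing m with
  | zero =>
    exact contDiff_zero.2 (continuous_iff_continuousAt.2 fun p =>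
      (hasFDerivAt_tychSeries hc hd m p).continuousAt)
  | succ N ih =>
    exact contDiff_succ_iff_hasFDerivAt.2 ⟨_, ((ih (m + 1)).smul contDiff_const).add
      ((contDiff_const.mul (ih (m + 2))).smul contDiff_const),
      hasFDerivAt_tychSeries hc hd m⟩

/-- Coefficients of Tychonoff's series: rescaled derivatives of the bump in the even places. -/
def tychCoeff (κ δ t₀ : ℝ) (k : ℕ) (t : ℝ) : ℝ :=
  if Even k then ((2 * δ * κ)⁻¹) ^ (k / 2) * flatD (k / 2) ((t - t₀ + δ) / (2 * δ)) else 0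

lemma tychCoeff_bound {κ δ : ℝ} (hκ : 0 < κ) (hδ : 0 < δ) (t₀ : ℝ) {ε : ℝ} (hε : 0 < ε) :
    ∃ C : ℝ, ∀ k t, |tychCoeff κ δ t₀ k t| ≤ C * (ε ^ k * k.factorial) := by
  obtain ⟨C, hC⟩ := flatD_gevrey (ε := ε ^ 2 * (2 * δ * κ)) (by positivity)
  have hC0 : 0 ≤ C := by simpa using (abs_nonneg _).trans (hC 0 0)
  refine ⟨C, fun k t => ?_⟩
  by_cases hk : Even k
  · obtain ⟨j, rfl⟩ := hk
    rw [← two_mul, tychCoeff, if_pos (even_two_mul j), Nat.mul_div_cancel_left _ two_pos, abs_mul,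
      abs_of_pos (by positivity)]
    calc _ ≤ ((2 * δ * κ)⁻¹) ^ j * (C * ((ε ^ 2 * (2 * δ * κ)) ^ j * (2 * j).factorial)) := by
          gcongr; exact hC _ _
      _ = _ := by
          rw [mul_pow (ε ^ 2), ← pow_mul, inv_pow]
          field_simp
  · rw [tychCoeff, if_neg hk, abs_zero]
    positivity

lemma hasDerivAt_tychCoeff {κ δ : ℝ} (hκ : 0 < κ) (hδ : 0 < δ) (t₀ : ℝ) (k : ℕ) (t : ℝ) :
    HasDerivAt (tychCoeff κ δ t₀ k) (κ * tychCoeff κ δ t₀ (k + 2) t) t := by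
  by_cases hk : Even k
  · have h1 : HasDerivAt (fun t => (t - t₀ + δ) / (2 * δ)) (1 / (2 * δ)) t :=
      (((hasDerivAt_id t).sub_const t₀).add_const δ).div_const _
    have h2 := ((hasDerivAt_flatD (k / 2) _).comp t h1).const_mul (((2 * δ * κ)⁻¹) ^ (k / 2))
    have e : tychCoeff κ δ t₀ k = fun t =>
        ((2 * δ * κ)⁻¹) ^ (k / 2) * flatD (k / 2) ((t - t₀ + δ) / (2 * δ)) := by
      funext s
      exact if_pos hk
    rw [e]
    refine h2.congr_deriv ?_
    rw [tychCoeff, if_pos (hk.add even_two), Nat.add_div_right _ two_pos, pow_succ]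
    field_simp
  · have e : ∀ j, Even (j - k) → k ≤ j → tychCoeff κ δ t₀ j = fun _ => 0 := by
      intro j hj hkj
      funext s
      refine if_neg fun h => hk ?_
      rw [Nat.even_sub hkj] at hj
      exact hj.1 h
    rw [e k (by simp) le_rfl, e (k + 2) (by simp) (by omega), mul_zero]
    exact hasDerivAt_const t 0

lemma tychCoeff_eq_zero {κ δ t₀ : ℝ} (hδ : 0 < δ) {t : ℝ} (ht : δ ≤ |t - t₀|) (k : ℕ) :
    tychCoeff κ δ t₀ k t = 0 := by
  have : flatD (k / 2) ((t - t₀ + δ) / (2 * δ)) = 0 := by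
    refine if_neg fun h => ?_
    rw [lt_div_iff₀ (by positivity), div_lt_one (by positivity)] at h
    exact absurd (abs_lt.2 ⟨by linarith [h.1], by linarith [h.2]⟩) (not_lt.2 ht)
  rw [tychCoeff, this, mul_zero, ite_self]

lemma tychSeries_at_zero (c : ℕ → ℝ → ℝ) (t : ℝ) : tychSeries c 0 (0, t) = c 0 t := by
  rw [tychSeries, tsum_eq_single 0 fun k hk => by simp [hk]]
  simp

/-- Space derivatives of a plane wave profile depending on one coordinate. -/
lemma sd_comp_coord {n : ℕ} {F : ℝ × ℝ → ℝ} {G : ℝ × ℝ → ℝ} {H : ℝ × ℝ → ℝ}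
    (hF : ∀ p, HasFDerivAt F (G p • ContinuousLinearMap.fst ℝ ℝ ℝ +
      H p • ContinuousLinearMap.snd ℝ ℝ ℝ) p) (a : ℝ) (i k : Fin n) :
    sd k (fun q : Spc n × ℝ => F (q.1 i - a, q.2)) =
      fun q => if k = i then G (q.1 i - a, q.2) else 0 := by
  funext p
  have h1 : HasFDerivAt (fun x : Spc n => (x i - a, p.2))
      ((EuclideanSpace.proj i : Spc n →L[ℝ] ℝ).prod 0) p.1 :=
    ((EuclideanSpace.proj i : Spc n →L[ℝ] ℝ).hasFDerivAt.sub_const a).prodMk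
      (hasFDerivAt_const p.2 p.1)
  have h2 : HasFDerivAt (fun x : Spc n => F (x i - a, p.2)) _ p.1 := (hF _).comp p.1 h1
  rw [sd, h2.fderiv]
  by_cases h : k = i
  · subst h; simp
  · simp [h, Ne.symm h]

lemma td_comp_coord {n : ℕ} {F : ℝ × ℝ → ℝ} {G : ℝ × ℝ → ℝ} {H : ℝ × ℝ → ℝ}
    (hF : ∀ p, HasFDerivAt F (G p • ContinuousLinearMap.fst ℝ ℝ ℝ +
      H p • ContinuousLinearMap.snd ℝ ℝ ℝ) p) (a : ℝ) (i : Fin n) (p : Spc n × ℝ) :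
    td (fun q : Spc n × ℝ => F (q.1 i - a, q.2)) p = H (p.1 i - a, p.2) := by
  have h1 : HasDerivAt (fun t : ℝ => (p.1 i - a, t)) (0, 1) p.2 :=
    (hasDerivAt_const p.2 _).prodMk (hasDerivAt_id p.2)
  have h2 : HasDerivAt (fun t : ℝ => F (p.1 i - a, t)) _ p.2 :=
    (hF _).comp_hasDerivAt p.2 h1
  rw [td, h2.deriv]
  simp

lemma sd_zero {n : ℕ} (k : Fin n) : sd k (fun _ : Spc n × ℝ => (0 : ℝ)) = fun _ => 0 := by
  funext p
  simp [sd]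

lemma lame0_tychSeries {n : ℕ} {μ lam : ℝ} {c : ℕ → ℝ → ℝ}
    (hc : ∀ ε : ℝ, 0 < ε → ∃ C : ℝ, ∀ k t, |c k t| ≤ C * (ε ^ k * k.factorial))
    (hd : ∀ k t, HasDerivAt (c k) ((2 * μ + lam) * c (k + 2) t) t) (a : ℝ) (i₀ : Fin n)
    (p : Spc n × ℝ) (i : Fin n) :
    lame0 n μ lam
      (fun q j => if j = i₀ then tychSeries c 0 (q.1 i₀ - a, q.2) else 0) p i = 0 := by
  have hs : ∀ (m : ℕ) (k : Fin n),
      sd k (fun q : Spc n × ℝ => tychSeries c m (q.1 i₀ - a, q.2)) = fun q =>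
        if k = i₀ then tychSeries c (m + 1) (q.1 i₀ - a, q.2) else 0 := fun m k =>
    sd_comp_coord (hasFDerivAt_tychSeries hc hd m) a i₀ k
  have hdiv : (fun q : Spc n × ℝ => ∑ k, sd k (fun q' : Spc n × ℝ =>
      if k = i₀ then tychSeries c 0 (q'.1 i₀ - a, q'.2) else 0) q) =
      fun q => tychSeries c 1 (q.1 i₀ - a, q.2) := by
    funext q
    rw [Finset.sum_eq_single i₀]
    · simp [hs]
    · intro k _ hk
      simp [hk, sd_zero]
    · simp
  rw [lame0, hdiv, hs]
  by_cases hi : i = i₀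
  · subst hi
    have hlap : ∑ k, sd k (sd k (fun q : Spc n × ℝ => tychSeries c 0 (q.1 i - a, q.2))) p =
        tychSeries c 2 (p.1 i - a, p.2) := by
      rw [Finset.sum_eq_single i]
      · simp [hs]
      · intro k _ hk
        simp [hs, hk, sd_zero]
      · simp
    simp only [if_true, hlap, td_comp_coord (hasFDerivAt_tychSeries hc hd 0)]
    ring
  · simp [hi, sd_zero, td]

/-- **A nontrivial flat solution of the parabolic Lamé system.** For every point
`(x₀,t₀) ∈ ℝⁿ × ℝ` and every `δ > 0` there exists a smooth vector field
`v₀ : ℝⁿ × ℝ → ℝⁿ` with `ℒ⁰v₀ = 0` everywhere, `v₀(x₀,t₀) ≠ 0`, and `v₀(x,t) = 0`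
for all `x` whenever `|t − t₀| ≥ δ`. -/
theorem stmt_8 (n : ℕ) (hn : 1 ≤ n) (μ lam : ℝ) (hμ : 0 < μ) (hlam : 0 ≤ lam + μ)
    (x₀ : Spc n) (t₀ δ : ℝ) (hδ : 0 < δ) :
    ∃ v₀ : Spc n × ℝ → Fin n → ℝ, ContDiff ℝ (⊤ : ℕ∞) v₀ ∧
      (∀ p : Spc n × ℝ, ∀ i : Fin n, lame0 n μ lam v₀ p i = 0) ∧
      v₀ (x₀, t₀) ≠ 0 ∧
      (∀ (x : Spc n) (t : ℝ), δ ≤ |t - t₀| → v₀ (x, t) = 0) := by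
  let i₀ : Fin n := ⟨0, hn⟩
  have hκ : 0 < 2 * μ + lam := by linarith
  set c := tychCoeff (2 * μ + lam) δ t₀ with hcdef
  have hc : ∀ ε : ℝ, 0 < ε → ∃ C : ℝ, ∀ k t, |c k t| ≤ C * (ε ^ k * k.factorial) :=
    fun ε hε => tychCoeff_bound hκ hδ t₀ hε
  have hd : ∀ k t, HasDerivAt (c k) ((2 * μ + lam) * c (k + 2) t) t :=
    hasDerivAt_tychCoeff hκ hδ t₀
  refine ⟨fun q j => if j = i₀ then tychSeries c 0 (q.1 i₀ - x₀ i₀, q.2) else 0, ?_,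
    lame0_tychSeries hc hd (x₀ i₀) i₀, fun h => ?_, fun x t ht => ?_⟩
  · refine contDiff_pi.2 fun j => ?_
    by_cases hj : j = i₀
    · simp only [hj, if_true]
      have hlin : ContDiff ℝ (⊤ : ℕ∞) fun q : Spc n × ℝ => (q.1 i₀ - x₀ i₀, q.2) :=
        (((EuclideanSpace.proj i₀ : Spc n →L[ℝ] ℝ).contDiff.comp contDiff_fst).sub
          contDiff_const).prodMk contDiff_snd
      exact (contDiff_tychSeries hc hd 0).comp hlin
    · simp only [hj, if_false]
      exact contDiff_const
  · have h0 := congrFun h i₀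
    simp only [if_true, sub_self, tychSeries_at_zero, Pi.zero_apply] at h0
    have e : (δ / (2 * δ)) = 1 / 2 := by field_simp
    apply flatD_zero_half
    simpa [hcdef, tychCoeff, e] using h0
  · funext j
    have h0 : tychSeries c 0 (x i₀ - x₀ i₀, t) = 0 := by
      simp [tychSeries, hcdef, tychCoeff_eq_zero hδ ht]
    simp only [h0, ite_self, Pi.zero_apply]
end
end
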